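/- arXiv:1611.04903 — 2 statements merged into one kernel-verified Lean document; each statement's English description precedes it below -/
import Mathlib

section
/- Let A, B be integers with |A| ≤ B and 2|A| ≥ B + 3, let M be the 2×2 real matrix with rows (0, −B) and (1, −A), and let T be the unique nonempty compact subset of ℝ² satisfying M·T + ((B−1)/2, 0) = (⋃_{i=0}^{B−2} (T + (i,0))) ∪ (−T). Then the intersection T ∩ (−T) contains at least two distinct points. -/
open Set Pointwise

noncomputable section

/-- The plane. -/
abbrev Pt : Type := Fin 2 → ℝ

/-- A planar set is disk-like if it is homeomorphic to the closed unit (Euclidean) disk. -/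
def DiskLike (S : Set Pt) : Prop :=
  Nonempty (↥S ≃ₜ ↥(Metric.closedBall (0 : EuclideanSpace ℝ (Fin 2)) 1))

/-- The set equation `M T + ((B-1)/2, 0) = (⋃_{i=0}^{B-2} (T + (i,0))) ∪ (-T)`
for `M = !![0, -B; 1, -A]`. -/
def CrysEq (A B : ℤ) (T : Set Pt) : Prop :=
  (fun x => (!![0, -(B:ℝ); 1, -(A:ℝ)]).mulVec x + ![((B:ℝ)-1)/2, 0]) '' T
    = (⋃ i ∈ Finset.Icc (0:ℤ) (B-2), (fun x => x + ![(i:ℝ), 0]) '' T) ∪ (-T)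

/-- The set equation `M L = ⋃_{i=0}^{B-1} (L + (i,0))` for `M = !![0, -B; 1, -A]`. -/
def LatEq (A B : ℤ) (L : Set Pt) : Prop :=
  (fun x => (!![0, -(B:ℝ); 1, -(A:ℝ)]).mulVec x) '' L
    = ⋃ i ∈ Finset.Icc (0:ℤ) (B-1), (fun x => x + ![(i:ℝ), 0]) '' L

/-- Membership in the crystallographic group p2: maps `x ↦ ε x + (p,q)`,
`ε = ±1`, `p q` integers. -/
def IsP2 (γ : Pt → Pt) : Prop :=
  ∃ (ε : ℝ) (p q : ℤ), (ε = 1 ∨ ε = -1) ∧ γ = fun x => ε • x + ![(p:ℝ), (q:ℝ)]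

namespace CrysEq

variable {A B : ℤ} {T : Set Pt}

lemma exists_shift_preimage (hT : CrysEq A B T) {i : ℤ} (h0 : 0 ≤ i) (hi : i ≤ B - 2)
    {t : Pt} (ht : t ∈ T) :
    ∃ s ∈ T, t 0 + i = -B * s 1 + (B - 1) / 2 ∧ t 1 = s 0 - A * s 1 := by
  have hmem : t + ![(i : ℝ), 0] ∈
      (⋃ i ∈ Finset.Icc (0 : ℤ) (B - 2), (fun x => x + ![(i : ℝ), 0]) '' T) ∪ (-T) :=
    Or.inl (Set.mem_biUnion (Finset.mem_coe.2 (Finset.mem_Icc.2 ⟨h0, hi⟩)) ⟨t, ht, rfl⟩)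
  rw [← hT] at hmem
  obtain ⟨s, hs, hst⟩ := hmem
  refine ⟨s, hs, ?_, ?_⟩
  · have := congrFun hst 0
    simp [dotProduct] at this
    linarith
  · have := congrFun hst 1
    simp [dotProduct] at this
    linarith

lemma exists_neg_preimage (hT : CrysEq A B T) {t : Pt} (ht : t ∈ T) :
    ∃ s ∈ T, -t 0 = -B * s 1 + (B - 1) / 2 ∧ -t 1 = s 0 - A * s 1 := by
  have hmem : -t ∈
      (⋃ i ∈ Finset.Icc (0 : ℤ) (B - 2), (fun x => x + ![(i : ℝ), 0]) '' T) ∪ (-T) :=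
    Or.inr (Set.neg_mem_neg.2 ht)
  rw [← hT] at hmem
  obtain ⟨s, hs, hst⟩ := hmem
  refine ⟨s, hs, ?_, ?_⟩
  · have := congrFun hst 0
    simp [dotProduct] at this
    linarith
  · have := congrFun hst 1
    simp [dotProduct] at this
    linarith

lemma mem_of_shift (hT : CrysEq A B T) (hB : 0 < B) {i : ℤ} (h0 : 0 ≤ i) (hi : i ≤ B - 2)
    {t x : Pt} (ht : t ∈ T) (hx0 : t 0 + i = -B * x 1 + (B - 1) / 2)
    (hx1 : t 1 = x 0 - A * x 1) : x ∈ T := by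
  obtain ⟨s, hs, hs0, hs1⟩ := hT.exists_shift_preimage h0 hi ht
  have hB' : (B : ℝ) ≠ 0 := by exact_mod_cast hB.ne'
  have h1 : x 1 = s 1 := mul_left_cancel₀ hB' (by linarith)
  have h2 : x 0 = s 0 := by rw [h1] at hx1; linarith
  have : x = s := by ext j; fin_cases j <;> assumption
  exact this ▸ hs

lemma mem_of_neg (hT : CrysEq A B T) (hB : 0 < B)
    {t x : Pt} (ht : t ∈ T) (hx0 : -t 0 = -B * x 1 + (B - 1) / 2)
    (hx1 : -t 1 = x 0 - A * x 1) : x ∈ T := by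
  obtain ⟨s, hs, hs0, hs1⟩ := hT.exists_neg_preimage ht
  have hB' : (B : ℝ) ≠ 0 := by exact_mod_cast hB.ne'
  have h1 : x 1 = s 1 := mul_left_cancel₀ hB' (by linarith)
  have h2 : x 0 = s 0 := by rw [h1] at hx1; linarith
  have : x = s := by ext j; fin_cases j <;> assumption
  exact this ▸ hs

end CrysEq

/-- A quadratic form that strictly increases under `!![0, -B; 1, -A]` when `|A| ≤ B`, `2 ≤ B`. -/
def lyapunovForm (A B : ℤ) (p q : ℝ) : ℝ :=
  (B ^ 2 - 1) * (B + 1) * p ^ 2 - 2 * A * B ^ 2 * p * q + B ^ 2 * (B + 1) * q ^ 2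

lemma lyapunovForm_neg (A B : ℤ) (p q : ℝ) :
    lyapunovForm A B (-p) (-q) = lyapunovForm A B p q := by
  unfold lyapunovForm; ring

lemma eq_zero_of_lyapunovForm_le {A B : ℤ} (hAB : |A| ≤ B) (hB : 2 ≤ B) {p q : ℝ}
    (h : lyapunovForm A B (-B * q) (p - A * q) ≤ lyapunovForm A B p q) : p = 0 ∧ q = 0 := by
  have hB' : (2 : ℝ) ≤ B := by exact_mod_cast hB
  have hA : (A : ℝ) ^ 2 ≤ B ^ 2 := by
    exact_mod_cast sq_le_sq.2 (hAB.trans (le_abs_self B))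
  have key : lyapunovForm A B (-B * q) (p - A * q) - lyapunovForm A B p q =
      (B + 1) * p ^ 2 + B ^ 2 * ((B ^ 2 - 2) * (B + 1) - A ^ 2 * (B - 1)) * q ^ 2 := by
    unfold lyapunovForm; ring
  have hpos : (0 : ℝ) < (B ^ 2 - 2) * (B + 1) - A ^ 2 * (B - 1) := by
    nlinarith [mul_le_mul_of_nonneg_right hA (by linarith : (0 : ℝ) ≤ B - 1)]
  have hq : (0 : ℝ) < B ^ 2 * ((B ^ 2 - 2) * (B + 1) - A ^ 2 * (B - 1)) := by positivity
  have hp : (0 : ℝ) < B + 1 := by linarith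
  have hp0 := mul_nonneg hp.le (sq_nonneg p)
  have hq0 := mul_nonneg hq.le (sq_nonneg q)
  have hp1 : (B + 1 : ℝ) * p ^ 2 = 0 := by linarith
  have hq1 : (B : ℝ) ^ 2 * ((B ^ 2 - 2) * (B + 1) - A ^ 2 * (B - 1)) * q ^ 2 = 0 := by linarith
  constructor
  · simpa [hp.ne'] using hp1
  · exact pow_eq_zero_iff two_ne_zero |>.1 ((mul_eq_zero.1 hq1).resolve_left hq.ne')

lemma exists_lyapunovForm_sub_min (A B : ℤ) {T : Set Pt} (hTne : T.Nonempty) (hTc : IsCompact T)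
    (x : Pt) : ∃ t ∈ T, ∀ s ∈ T,
      lyapunovForm A B (x 0 - t 0) (x 1 - t 1) ≤ lyapunovForm A B (x 0 - s 0) (x 1 - s 1) := by
  refine hTc.exists_isMinOn (f := fun t : Pt => lyapunovForm A B (x 0 - t 0) (x 1 - t 1)) hTne ?_
  unfold lyapunovForm
  fun_prop

namespace CrysEq

variable {A B : ℤ} {T : Set Pt}

lemma mem_of_fixed_shift (hT : CrysEq A B T) (hAB : |A| ≤ B) (hTne : T.Nonempty)
    (hTc : IsCompact T) {i : ℤ} (h0 : 0 ≤ i) (hi : i ≤ B - 2) {x : Pt}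
    (hx0 : x 0 + i = -B * x 1 + (B - 1) / 2) (hx1 : x 1 = x 0 - A * x 1) : x ∈ T := by
  obtain ⟨t, ht, hmin⟩ := exists_lyapunovForm_sub_min A B hTne hTc x
  obtain ⟨s, hs, hs0, hs1⟩ := hT.exists_shift_preimage h0 hi ht
  have h := hmin s hs
  rw [show x 0 - t 0 = -B * (x 1 - s 1) by linarith,
    show x 1 - t 1 = (x 0 - s 0) - A * (x 1 - s 1) by linarith] at h
  obtain ⟨hp, hq⟩ := eq_zero_of_lyapunovForm_le hAB (by lia) h
  have : x = s := by ext j; fin_cases j <;> simp <;> linarith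
  exact this ▸ hs

lemma mem_of_fixed_neg (hT : CrysEq A B T) (hAB : |A| ≤ B) (hB : 2 ≤ B) (hTne : T.Nonempty)
    (hTc : IsCompact T) {x : Pt}
    (hx0 : -x 0 = -B * x 1 + (B - 1) / 2) (hx1 : -x 1 = x 0 - A * x 1) : x ∈ T := by
  obtain ⟨t, ht, hmin⟩ := exists_lyapunovForm_sub_min A B hTne hTc x
  obtain ⟨s, hs, hs0, hs1⟩ := hT.exists_neg_preimage ht
  have h := hmin s hs
  rw [← lyapunovForm_neg, show -(x 0 - t 0) = -B * (x 1 - s 1) by linarith,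
    show -(x 1 - t 1) = (x 0 - s 0) - A * (x 1 - s 1) by linarith] at h
  obtain ⟨hp, hq⟩ := eq_zero_of_lyapunovForm_le hAB hB h
  have : x = s := by ext j; fin_cases j <;> simp <;> linarith
  exact this ▸ hs

lemma exists_ne_zero_of_four_le (hT : CrysEq A B T) (hAB : |A| ≤ B) (hB : 4 ≤ B)
    (hTne : T.Nonempty) (hTc : IsCompact T) : ∃ x ∈ T, -x ∈ T ∧ x ≠ 0 := by
  have hB' : (4 : ℝ) ≤ B := by exact_mod_cast hB
  have hD : (0 : ℝ) < 1 + A + B := by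
    have : 0 < 1 + A + B := by have := neg_abs_le A; lia
    exact_mod_cast this
  set q : ℝ := (B - 3) / 2 / (1 + A + B) with hq
  have hqD : q * (1 + A + B) = (B - 3) / 2 := div_mul_cancel₀ _ hD.ne'
  have hq0 : q ≠ 0 := (div_pos (by linarith) hD).ne'
  refine ⟨![(1 + A) * q, q], ?_, ?_, ?_⟩
  · refine hT.mem_of_fixed_shift hAB hTne hTc (i := 1) (by lia) (by lia) ?_ ?_
    · simp; linarith
    · simp; ring
  · refine hT.mem_of_fixed_shift hAB hTne hTc (i := B - 2) (by lia) (by lia) ?_ ?_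
    · simp; linarith
    · simp; ring
  · intro h
    exact hq0 (by simpa using congrFun h 1)

lemma exists_ne_zero_three (hT : CrysEq 3 3 T) (hTne : T.Nonempty) (hTc : IsCompact T) :
    ∃ x ∈ T, -x ∈ T ∧ x ≠ 0 := by
  have hfix : ![2, 1] ∈ T := by
    refine hT.mem_of_fixed_neg (by norm_num) (by norm_num) hTne hTc ?_ ?_ <;> norm_num
  have a₁ : ![0, -1 / 3] ∈ T := by
    refine hT.mem_of_shift (i := 0) (by norm_num) (by norm_num) (by norm_num) hfix ?_ ?_ <;>
      norm_num
  have a₂ : ![4 / 3, 1 / 3] ∈ T := by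
    refine hT.mem_of_neg (by norm_num) a₁ ?_ ?_ <;> norm_num
  have a₃ : ![-1, -4 / 9] ∈ T := by
    refine hT.mem_of_shift (i := 1) (by norm_num) (by norm_num) (by norm_num) a₂ ?_ ?_ <;>
      norm_num
  have b₁ : ![-1, -2 / 3] ∈ T := by
    refine hT.mem_of_shift (i := 1) (by norm_num) (by norm_num) (by norm_num) hfix ?_ ?_ <;>
      norm_num
  have b₂ : ![1 / 3, 1 / 3] ∈ T := by
    refine hT.mem_of_shift (i := 1) (by norm_num) (by norm_num) (by norm_num) b₁ ?_ ?_ <;>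
      norm_num
  have b₃ : -![-1, -4 / 9] ∈ T := by
    refine hT.mem_of_neg (by norm_num) b₂ ?_ ?_ <;> norm_num
  refine ⟨_, a₃, b₃, fun h => ?_⟩
  have := congrFun h 0
  norm_num at this

lemma exists_ne_zero_neg_three (hT : CrysEq (-3) 3 T) (hTne : T.Nonempty) (hTc : IsCompact T) :
    ∃ x ∈ T, -x ∈ T ∧ x ≠ 0 := by
  have hfix : ![-2, 1] ∈ T := by
    refine hT.mem_of_fixed_shift (i := 0) (by norm_num) hTne hTc (by norm_num) (by norm_num)
      ?_ ?_ <;> norm_num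
  have a₁ : ![-1, 2 / 3] ∈ T := by
    refine hT.mem_of_shift (i := 1) (by norm_num) (by norm_num) (by norm_num) hfix ?_ ?_ <;>
      norm_num
  have a₂ : ![-1 / 3, 1 / 3] ∈ T := by
    refine hT.mem_of_shift (i := 1) (by norm_num) (by norm_num) (by norm_num) a₁ ?_ ?_ <;>
      norm_num
  have a₃ : ![0, 1 / 9] ∈ T := by
    refine hT.mem_of_shift (i := 1) (by norm_num) (by norm_num) (by norm_num) a₂ ?_ ?_ <;>
      norm_num
  have b₁ : ![0, -1 / 3] ∈ T := by
    refine hT.mem_of_neg (by norm_num) hfix ?_ ?_ <;> norm_num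
  have b₂ : ![-4 / 3, 1 / 3] ∈ T := by
    refine hT.mem_of_shift (i := 0) (by norm_num) (by norm_num) (by norm_num) b₁ ?_ ?_ <;>
      norm_num
  have b₃ : -![0, 1 / 9] ∈ T := by
    refine hT.mem_of_neg (by norm_num) b₂ ?_ ?_ <;> norm_num
  refine ⟨_, a₃, b₃, fun h => ?_⟩
  have := congrFun h 1
  norm_num at this

end CrysEq

theorem stmt_18 (A B : ℤ) (hAB : |A| ≤ B) (h2A : B + 3 ≤ 2 * |A|)
    (T : Set Pt) (hTne : T.Nonempty) (hTc : IsCompact T) (hT : CrysEq A B T) :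
    ∃ x ∈ T ∩ (-T), ∃ y ∈ T ∩ (-T), x ≠ y := by
  suffices h : ∃ x ∈ T, -x ∈ T ∧ x ≠ 0 by
    obtain ⟨x, hx, hnx, hx0⟩ := h
    refine ⟨x, ⟨hx, hnx⟩, -x, ⟨hnx, Set.neg_mem_neg.2 hx⟩, fun h => hx0 ?_⟩
    exact self_eq_neg.1 h
  rcases (show 3 ≤ B by lia).eq_or_lt with rfl | hB
  · rcases eq_or_eq_neg_of_abs_eq (show |A| = 3 by lia) with rfl | rfl
    · exact hT.exists_ne_zero_three hTne hTc
    · exact hT.exists_ne_zero_neg_three hTne hTc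
  · exact hT.exists_ne_zero_of_four_le hAB hB hTne hTc
end
end

section
/- Let A, B be integers with |A| ≤ B, B ≥ 2 and 2|A| ≥ B + 3, let M be the 2×2 real matrix with rows (0, −B) and (1, −A), and let T be the unique nonempty compact subset of ℝ² satisfying M·T + ((B−1)/2, 0) = (⋃_{i=0}^{B−2} (T + (i,0))) ∪ (−T). Then T is not disk-like, i.e. T is not homeomorphic to the closed unit disk {x ∈ ℝ² : ‖x‖ ≤ 1}. -/
open Set Pointwise

noncomputable section

lemma exists_continuous_log {E : Type*} [NormedAddCommGroup E] [NormedSpace ℝ E] {F : E → ℂ}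
    (hF : Continuous F) (hF0 : ∀ x, F x ≠ 0) :
    ∃ g : E → ℂ, Continuous g ∧ ∀ x, Complex.exp (g x) = F x := by
  let f : C(E, {z : ℂ // z ≠ 0}) := ⟨fun x => ⟨F x, hF0 x⟩, by fun_prop⟩
  obtain ⟨g, ⟨-, hg⟩, -⟩ := Complex.isCoveringMap_exp.existsUnique_continuousMap_lifts f 0
    (Complex.log (F 0)) (Subtype.ext (Complex.exp_log (hF0 0)))
  exact ⟨g, g.continuous, fun x => congrArg Subtype.val (congrFun hg x)⟩

lemma eq_of_exp_comp_eq {X : Type*} [TopologicalSpace X] [PreconnectedSpace X] {f g : X → ℂ}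
    (hf : Continuous f) (hg : Continuous g) (h : ∀ x, Complex.exp (f x) = Complex.exp (g x))
    {a : X} (ha : f a = g a) (x : X) : f x = g x :=
  congrFun (Complex.isCoveringMap_exp.eq_of_comp_eq hf hg
    (funext fun x => Subtype.ext (h x)) a ha) x

lemma exists_half_chord {Γ : ℝ → ℂ} (hΓ : Continuous Γ) {w : ℂ}
    (hper : ∀ s, Γ (s + 1) = Γ s + 2 * w) : ∃ s t, Γ s = Γ t + w := by
  by_contra! hne
  obtain ⟨θ, hθ, hθF⟩ := exists_continuous_log (E := ℝ × ℝ)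
    (F := fun p => Γ p.1 - Γ p.2 - w) (by fun_prop)
    (fun p h => hne p.1 p.2 (by linear_combination h))
  have hswap (p : ℝ × ℝ) : Complex.exp (θ (p.2, p.1 - 1)) = - Complex.exp (θ p) := by
    have := hper (p.1 - 1)
    rw [sub_add_cancel] at this
    rw [hθF, hθF, this]; ring
  set d : ℂ := θ (0, -1) - θ (0, 0) with hd
  have hdexp : Complex.exp d = -1 := by
    have h := hswap (0, 0)
    simp only [zero_sub] at h
    rw [hd, Complex.exp_sub, h, neg_div, div_self (Complex.exp_ne_zero _)]
  have hconst (p : ℝ × ℝ) : θ (p.2, p.1 - 1) = θ p + d := by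
    refine eq_of_exp_comp_eq (f := fun p : ℝ × ℝ => θ (p.2, p.1 - 1)) (g := fun p => θ p + d)
      (by fun_prop) (by fun_prop) (fun q => ?_) (a := (0, 0)) (by simp [hd]) p
    simp only [hswap, Complex.exp_add, hdexp, mul_neg, mul_one]
  have hdiag : θ (-1, -1) = θ (0, 0) := by
    refine eq_of_exp_comp_eq (f := fun u : ℝ => θ (u, u)) (g := fun _ => θ (0, 0))
      (by fun_prop) (by fun_prop) (fun u => ?_) (a := 0) rfl (-1)
    simp [hθF]
  have h1 := hconst (0, 0)
  have h2 := hconst (0, -1)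
  simp only [zero_sub] at h1 h2
  have hd0 : d = 0 := by
    have : 2 * d = 0 := by linear_combination hdiag - h1 - h2
    simpa using this
  rw [hd0, Complex.exp_zero] at hdexp
  norm_num at hdexp

lemma exists_half_chord_path {α : ℝ → ℂ} (hα : ContinuousOn α (Icc 0 1)) {w : ℂ}
    (h1 : α 1 = α 0 + 2 * w) :
    ∃ s ∈ Icc (0 : ℝ) 1, ∃ t ∈ Icc (0 : ℝ) 1, ∃ n : ℤ, α s = α t + (2 * n + 1) * w := by
  have hβ : Continuous (fun s : ℝ => α (Int.fract s) - 2 * (Int.fract s : ℝ) * w) :=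
    ContinuousOn.comp_fract'' (f := fun s : ℝ => α s - 2 * (s : ℂ) * w)
      (hα.sub (by fun_prop)) (by simp [h1])
  obtain ⟨s, t, hst⟩ := exists_half_chord (w := w)
    (Γ := fun s => α (Int.fract s) - 2 * (Int.fract s : ℝ) * w + 2 * s * w)
    (hβ.add (by fun_prop)) (fun s => by simp only [Int.fract_add_one]; push_cast; ring)
  refine ⟨Int.fract s, ⟨Int.fract_nonneg s, (Int.fract_lt_one s).le⟩, Int.fract t,
    ⟨Int.fract_nonneg t, (Int.fract_lt_one t).le⟩, ⌊t⌋ - ⌊s⌋, ?_⟩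
  have hs : (s : ℂ) = (⌊s⌋ : ℂ) + (Int.fract s : ℝ) := by exact_mod_cast (Int.floor_add_fract s).symm
  have ht : (t : ℂ) = (⌊t⌋ : ℂ) + (Int.fract t : ℝ) := by exact_mod_cast (Int.floor_add_fract t).symm
  push_cast
  rw [hs, ht] at hst
  linear_combination hst

lemma exists_zero_of_near_id_on_sphere {G : ℂ → ℂ}
    (hG : ContinuousOn G (Metric.closedBall 0 1)) (hclose : ∀ x, ‖x‖ = 1 → ‖G x - x‖ < 1) :
    ∃ x ∈ Metric.closedBall (0 : ℂ) 1, G x = 0 := by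
  by_contra! hne
  let ρ : ℂ → ℂ := fun x => (max 1 ‖x‖)⁻¹ • x
  have hpos (x : ℂ) : 0 < max 1 ‖x‖ := lt_max_of_lt_left one_pos
  have hρc : Continuous ρ :=
    ((continuous_const.max continuous_norm).inv₀ fun x => (hpos x).ne').smul continuous_id
  have hρ (x : ℂ) : ρ x ∈ Metric.closedBall (0 : ℂ) 1 := by
    rw [mem_closedBall_zero_iff, norm_smul, norm_inv, Real.norm_of_nonneg (hpos x).le,
      inv_mul_le_one₀ (hpos x)]
    exact le_max_right _ _
  obtain ⟨g, hg, hgF⟩ := exists_continuous_log (F := G ∘ ρ)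
    (hG.comp_continuous hρc hρ) (fun x => hne _ (hρ x))
  let u : ℝ → ℂ := fun t => Complex.exp (t * Complex.I)
  have hu : Continuous u := by fun_prop
  have hu1 (t : ℝ) : ‖u t‖ = 1 := Complex.norm_exp_ofReal_mul_I t
  have hu0 (t : ℝ) : u t ≠ 0 := Complex.exp_ne_zero _
  have hρu (t : ℝ) : ρ (u t) = u t := by simp [ρ, hu1]
  have hGu : Continuous fun t => G (u t) :=
    hG.comp_continuous hu fun t => by simp [hu1]
  let k : ℝ → ℂ := fun t => G (u t) / u t
  have hk : Continuous k := hGu.div hu hu0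
  have hkslit (t : ℝ) : k t ∈ Complex.slitPlane := by
    have : ‖k t - 1‖ < 1 := by
      have h : k t - 1 = (G (u t) - u t) / u t := by simp only [k]; field_simp [hu0 t]
      rw [h, norm_div, hu1, div_one]
      exact hclose _ (hu1 t)
    exact Complex.ball_one_subset_slitPlane (by rwa [Metric.mem_ball, dist_eq_norm])
  have hlog : Continuous fun t => Complex.log (k t) := hk.clog hkslit
  have hkey := eq_of_exp_comp_eq (f := fun t : ℝ => g (u t) - Complex.log (k t) - t * Complex.I)
    (g := fun _ => g (u 0) - Complex.log (k 0) - (0 : ℝ) * Complex.I)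
    (by fun_prop) (by fun_prop) (fun t => ?_) (a := 0) rfl (2 * Real.pi)
  · have h2 : u (2 * Real.pi) = u 0 := by simp [u]
    simp only [k, h2] at hkey
    have : (2 * Real.pi : ℂ) * Complex.I = 0 := by
      push_cast at hkey
      linear_combination -hkey
    simp [Real.pi_ne_zero] at this
  · have hone (t : ℝ) :
        Complex.exp (g (u t) - Complex.log (k t) - t * Complex.I) = 1 := by
      rw [Complex.exp_sub, Complex.exp_sub, hgF,
        Complex.exp_log (Complex.slitPlane_ne_zero (hkslit t))]
      have hGne : G (u t) ≠ 0 := hne _ (by simp [hu1])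
      have hut := hu0 t
      simp only [Function.comp, hρu, k]
      change G (u t) / (G (u t) / u t) / u t = 1
      field_simp
    rw [hone, hone]

open Metric MeasureTheory in
lemma map_zero_mem_interior_image_closedBall {φ : ℂ → ℂ} (hφ : ContinuousOn φ (closedBall 0 1))
    (hinj : InjOn φ (closedBall 0 1)) : φ 0 ∈ interior (φ '' closedBall 0 1) := by
  by_contra hint
  have hD : IsCompact (closedBall (0 : ℂ) 1) := isCompact_closedBall 0 1
  have hK : IsCompact (φ '' closedBall 0 1) := hD.image_of_continuousOn hφ
  obtain ⟨G, hGφ⟩ : ∃ G : C(ℂ, ℂ), ∀ x ∈ closedBall (0 : ℂ) 1, G (φ x) = x := by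
    have : CompactSpace (closedBall (0 : ℂ) 1) := isCompact_iff_compactSpace.1 hD
    have he : Topology.IsClosedEmbedding ((closedBall (0 : ℂ) 1).domRestrict φ) :=
      Continuous.isClosedEmbedding (continuousOn_iff_continuous_domRestrict.1 hφ) hinj.injective
    obtain ⟨G, hG⟩ := ContinuousMap.exists_extension' he
      (⟨Subtype.val, continuous_subtype_val⟩ : C(closedBall (0 : ℂ) 1, ℂ))
    exact ⟨G, fun x hx => congrFun hG ⟨x, hx⟩⟩
  have h0 : (0 : ℂ) ∈ closedBall (0 : ℂ) 1 := by simp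
  obtain ⟨η, hη, hGη⟩ : ∃ η > 0, ∀ y, dist y (φ 0) < η → ‖G y‖ < 1 := by
    obtain ⟨η, hη, h⟩ := Metric.continuous_iff.1 G.continuous (φ 0) 1 one_pos
    exact ⟨η, hη, fun y hy => by simpa [hGφ 0 h0] using h y hy⟩
  set ε := η / 2 with hε
  have hε0 : 0 < ε := by positivity
  obtain ⟨c, hcε, hcK⟩ : ∃ c, dist c (φ 0) < ε ∧ c ∉ φ '' closedBall 0 1 := by
    by_contra! h
    exact hint (mem_interior_iff_mem_nhds.2 (Filter.mem_of_superset (ball_mem_nhds _ hε0) h))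
  obtain ⟨δ, hδ0, hδ1, hδ⟩ : ∃ δ > 0, δ < 1 ∧
      ∀ y ∈ φ '' closedBall 0 1, ε ≤ dist y c → 2 * δ ≤ ‖G y‖ := by
    have hcpt : IsCompact (φ '' closedBall 0 1 ∩ {y | ε ≤ dist y c}) :=
      hK.inter_right (isClosed_le continuous_const (by fun_prop))
    obtain ⟨m, hm, hmin⟩ : ∃ m > 0, ∀ y ∈ φ '' closedBall 0 1 ∩ {y | ε ≤ dist y c}, m ≤ ‖G y‖ := by
      refine hcpt.exists_forall_le' (a := 0) (by fun_prop) ?_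
      rintro _ ⟨⟨x, hx, rfl⟩, hxc⟩
      rw [norm_pos_iff, hGφ x hx]
      rintro rfl
      rw [mem_ofPred_eq, dist_comm] at hxc
      exact absurd hcε hxc.not_gt
    refine ⟨min (m / 2) (1 / 2), by positivity, (min_le_right _ _).trans_lt (by norm_num),
      fun y hy hyc => ?_⟩
    have := hmin y ⟨hy, hyc⟩
    linarith [min_le_left (m / 2) (1 / 2 : ℝ)]
  obtain ⟨P, hP, hPG, -⟩ := G.continuous.exists_contDiff_approx 1
    (continuous_const (y := δ / 2)) (fun _ => half_pos hδ0)
  obtain ⟨a, haδ, haP⟩ : ∃ a, ‖a‖ < δ / 2 ∧ a ∉ P '' sphere c ε := by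
    by_contra! h
    have hnull : volume (P '' sphere c ε) = 0 :=
      addHaar_image_eq_zero_of_differentiableOn_of_addHaar_eq_zero volume
        (hP.differentiable one_ne_zero).differentiableOn (Measure.addHaar_sphere _ _ _)
    have hball : volume (ball (0 : ℂ) (δ / 2)) = 0 :=
      measure_mono_null (fun a ha => h a (mem_ball_zero_iff.1 ha)) hnull
    exact (measure_ball_pos volume (0 : ℂ) (half_pos hδ0)).ne' hball
  let Φ : ℂ → ℂ := fun y => c + max (ε / dist y c) 1 • (y - c)
  have hne (x : ℂ) (hx : x ∈ closedBall (0 : ℂ) 1) : dist (φ x) c ≠ 0 := by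
    rw [dist_ne_zero]
    rintro rfl
    exact hcK (mem_image_of_mem _ hx)
  have hΦ : ContinuousOn (fun x => Φ (φ x)) (closedBall 0 1) := by
    have h1 : ContinuousOn (fun x => ε / dist (φ x) c) (closedBall 0 1) :=
      continuousOn_const.div
        (continuous_dist.comp_continuousOn (hφ.prodMk continuousOn_const)) hne
    exact continuousOn_const.add ((h1.sup continuousOn_const).smul (hφ.sub continuousOn_const))
  have hΦfar {y : ℂ} (hy : ε ≤ dist y c) : Φ y = y := by
    simp only [Φ]
    rw [max_eq_right ((div_le_one (hε0.trans_le hy)).2 hy)]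
    simp
  have hΦnear {x : ℂ} (hx : x ∈ closedBall (0 : ℂ) 1) (hy : dist (φ x) c < ε) :
      Φ (φ x) ∈ sphere c ε := by
    have hpos : 0 < dist (φ x) c := dist_nonneg.lt_of_ne' (hne x hx)
    simp only [Φ]
    rw [max_eq_left ((one_le_div hpos).2 hy.le), mem_sphere_iff_norm, add_sub_cancel_left,
      norm_smul, ← dist_eq_norm, Real.norm_of_nonneg (by positivity),
      div_mul_cancel₀ _ hpos.ne']
  have hPa (y : ℂ) : ‖P y - a - G y‖ < δ := by
    have h1 := hPG y
    rw [dist_eq_norm] at h1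
    calc ‖P y - a - G y‖ = ‖(P y - G y) - a‖ := by ring_nf
      _ ≤ ‖P y - G y‖ + ‖a‖ := norm_sub_le _ _
      _ < δ := by linarith
  obtain ⟨x, hx, hzero⟩ := exists_zero_of_near_id_on_sphere (G := fun x => P (Φ (φ x)) - a)
    ((hP.continuous.comp_continuousOn hΦ).sub continuousOn_const) (fun x hx => by
      have hxD : x ∈ closedBall (0 : ℂ) 1 := by simp [hx]
      have hfar : ε ≤ dist (φ x) c := by
        by_contra! hlt
        have := hGη (φ x) ((dist_triangle _ c _).trans_lt (by linarith))
        rw [hGφ x hxD, hx] at this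
        exact lt_irrefl _ this
      have := hPa (φ x)
      rw [hGφ x hxD] at this
      simpa only [hΦfar hfar] using this.trans hδ1)
  rcases le_or_gt ε (dist (φ x) c) with hfar | hnear
  · have h1 := hPa (φ x)
    rw [hΦfar hfar] at hzero
    rw [hzero, zero_sub, norm_neg] at h1
    linarith [hδ _ (mem_image_of_mem φ hx) hfar]
  · exact haP ⟨_, hΦnear hx hnear, sub_eq_zero.1 hzero⟩

open Metric in
lemma map_mem_interior_image_closedBall {φ : ℂ → ℂ} (hφ : ContinuousOn φ (closedBall 0 1))
    (hinj : InjOn φ (closedBall 0 1)) {x : ℂ} (hx : x ∈ ball (0 : ℂ) 1) :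
    φ x ∈ interior (φ '' closedBall 0 1) := by
  rw [mem_ball_zero_iff] at hx
  set r := 1 - ‖x‖ with hr
  have hr0 : 0 < r := by linarith
  have hmaps : MapsTo (fun z : ℂ => x + r • z) (closedBall 0 1) (closedBall 0 1) := by
    intro z hz
    rw [mem_closedBall_zero_iff] at hz ⊢
    refine (norm_add_le _ _).trans ?_
    rw [norm_smul, Real.norm_of_nonneg hr0.le]
    nlinarith
  have := map_zero_mem_interior_image_closedBall (φ := fun z => φ (x + r • z))
    (hφ.comp (by fun_prop) hmaps)
    (hinj.comp (fun z _ z' _ h => smul_right_injective ℂ hr0.ne' (add_left_cancel h)) hmaps)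
  simp only [smul_zero, add_zero] at this
  refine interior_mono ?_ this
  rintro _ ⟨z, hz, rfl⟩
  exact mem_image_of_mem φ (hmaps hz)

lemma DiskLike.exists_parametrization {S : Set Pt} (hS : DiskLike S) :
    ∃ φ : ℂ → Pt, ContinuousOn φ (Metric.closedBall 0 1) ∧ φ '' Metric.closedBall 0 1 = S ∧
      φ '' Metric.ball 0 1 ⊆ interior S := by
  obtain ⟨h⟩ := hS
  let ι : ℂ ≃ₗᵢ[ℝ] EuclideanSpace ℝ (Fin 2) := Complex.orthonormalBasisOneI.repr
  let e : Pt ≃L[ℝ] ℂ := ContinuousLinearEquiv.ofFinrankEq (by simp)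
  have hι (z : ℂ) (hz : z ∈ Metric.closedBall (0 : ℂ) 1) :
      ι z ∈ Metric.closedBall (0 : EuclideanSpace ℝ (Fin 2)) 1 := by
    simpa [ι.norm_map] using hz
  let g : Metric.closedBall (0 : ℂ) 1 → Pt := fun z => h.symm ⟨ι z, hι z z.2⟩
  have hg : Continuous g :=
    continuous_subtype_val.comp (h.symm.continuous.comp
      ((ι.continuous.comp continuous_subtype_val).subtype_mk _))
  have hginj : Function.Injective g := by
    intro z z' hzz
    have := h.symm.injective (Subtype.ext hzz)
    exact Subtype.ext (ι.injective (congrArg Subtype.val this))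
  let φ : ℂ → Pt := Function.extend Subtype.val g 0
  have hφg (z : Metric.closedBall (0 : ℂ) 1) : φ z = g z :=
    Subtype.val_injective.extend_apply g 0 z
  have hφ : ContinuousOn φ (Metric.closedBall 0 1) := by
    rw [continuousOn_iff_continuous_domRestrict]
    exact hg.congr fun z => (hφg z).symm
  have hinj : InjOn φ (Metric.closedBall 0 1) := by
    intro z hz z' hz' hzz
    rw [hφg ⟨z, hz⟩, hφg ⟨z', hz'⟩] at hzz
    exact congrArg Subtype.val (hginj hzz)
  have himg : φ '' Metric.closedBall 0 1 = S := by
    ext x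
    constructor
    · rintro ⟨z, hz, rfl⟩
      rw [hφg ⟨z, hz⟩]
      exact Subtype.coe_prop _
    · intro hx
      have hz : ι.symm (h ⟨x, hx⟩ : EuclideanSpace ℝ (Fin 2)) ∈ Metric.closedBall (0 : ℂ) 1 := by
        rw [mem_closedBall_zero_iff, ι.symm.norm_map]
        exact mem_closedBall_zero_iff.1 (h ⟨x, hx⟩).2
      exact ⟨_, hz, by simp [hφg ⟨_, hz⟩, g]⟩
  refine ⟨φ, hφ, himg, ?_⟩
  rintro _ ⟨z, hz, rfl⟩
  have := map_mem_interior_image_closedBall (φ := e ∘ φ) (e.continuous.comp_continuousOn hφ)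
    (e.injective.comp_injOn hinj) hz
  rw [image_comp, himg, ← e.coe_toHomeomorph, ← e.toHomeomorph.image_interior] at this
  exact (e.toHomeomorph.injective.mem_set_image).1 this

lemma DiskLike.subset_closure_interior {S : Set Pt} (hS : DiskLike S) :
    S ⊆ closure (interior S) := by
  obtain ⟨φ, hφ, rfl, hint⟩ := hS.exists_parametrization
  rw [← closure_ball (0 : ℂ) one_ne_zero] at hφ
  calc φ '' Metric.closedBall 0 1 = φ '' closure (Metric.ball 0 1) := by
        rw [closure_ball (0 : ℂ) one_ne_zero]
    _ ⊆ closure (φ '' Metric.ball 0 1) := hφ.image_closure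
    _ ⊆ _ := closure_mono hint

lemma DiskLike.exists_path {S : Set Pt} (hS : DiskLike S) {x y : Pt} (hx : x ∈ S) (hy : y ∈ S)
    (hxy : x ≠ y) :
    ∃ α : ℝ → Pt, ContinuousOn α (Icc 0 1) ∧ α 0 = x ∧ α 1 = y ∧
      ∀ t ∈ Ioo (0 : ℝ) 1, α t ∈ interior S := by
  obtain ⟨φ, hφ, rfl, hint⟩ := hS.exists_parametrization
  obtain ⟨a, ha, rfl⟩ := hx
  obtain ⟨b, hb, rfl⟩ := hy
  have hab : a ≠ b := fun h => hxy (congrArg φ h)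
  refine ⟨fun t => φ (AffineMap.lineMap a b t), hφ.comp (by fun_prop) ?_, by simp, by simp, ?_⟩
  · intro t ht
    exact (convex_closedBall (0 : ℂ) 1).lineMap_mem ha hb ht
  · intro t ht
    refine hint (mem_image_of_mem φ ?_)
    rw [← interior_closedBall (0 : ℂ) one_ne_zero]
    refine (strictConvex_closedBall ℝ (0 : ℂ) 1).openSegment_subset ha hb hab ?_
    rw [openSegment_eq_image_lineMap]
    exact mem_image_of_mem _ ht

lemma no_path_of_odd_translates_disjoint {S E : Set Pt} {w : Pt}
    (hdisj : ∀ n : ℤ, ∀ x ∈ interior S, x - ((2 * n + 1 : ℤ) : ℝ) • w ∉ S)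
    (hE : ∀ n : ℤ, ∀ x ∈ E, x - ((2 * n + 1 : ℤ) : ℝ) • w ∉ E) {α : ℝ → Pt}
    (hα : ContinuousOn α (Icc 0 1)) (h1 : α 1 = α 0 + (2 : ℝ) • w)
    (hS : ∀ t ∈ Icc (0 : ℝ) 1, α t ∈ S)
    (hint : ∀ t ∈ Icc (0 : ℝ) 1, α t ∈ interior S ∨ α t ∈ E) : False := by
  let e : Pt ≃L[ℝ] ℂ := ContinuousLinearEquiv.ofFinrankEq (by simp)
  obtain ⟨s, hs, t, ht, n, hst⟩ := exists_half_chord_path (α := e ∘ α) (w := e w)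
    (e.continuous.comp_continuousOn hα) (by simp [h1])
  have hst' : α s = α t + ((2 * n + 1 : ℤ) : ℝ) • w := by
    apply e.injective
    simpa using hst
  have hts : α t = α s - ((2 * n + 1 : ℤ) : ℝ) • w := by rw [hst']; abel
  have hts' : α s = α t - ((2 * (-n - 1) + 1 : ℤ) : ℝ) • w := by
    rw [hst', sub_eq_add_neg, ← neg_smul]; congr 2; push_cast; ring
  rcases hint s hs with h | h
  · exact hdisj n _ h (hts ▸ hS t ht)
  rcases hint t ht with h' | h'
  · exact hdisj (-n - 1) _ h' (hts' ▸ hS s hs)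
  · exact hE n _ h (hts ▸ h')

lemma companion_mulVec (A B : ℤ) (x : Pt) :
    (!![0, -(B:ℝ); 1, -(A:ℝ)]).mulVec x = ![-(B:ℝ) * x 1, x 0 - A * x 1] := by
  ext i
  fin_cases i <;> simp [Matrix.mulVec, dotProduct, Fin.sum_univ_two]
  ring

/-- The affine expansion `x ↦ M x + ((B-1)/2, 0)` underlying `CrysEq`. -/
def expansion (A B : ℤ) (x : Pt) : Pt :=
  (!![0, -(B:ℝ); 1, -(A:ℝ)]).mulVec x + ![((B:ℝ)-1)/2, 0]

lemma expansion_eq (A B : ℤ) (x : Pt) :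
    expansion A B x = ![-(B:ℝ) * x 1 + ((B:ℝ)-1)/2, x 0 - A * x 1] := by
  rw [expansion, companion_mulVec]
  ext i
  fin_cases i <;> simp

lemma expansion_neg (A B : ℤ) (x : Pt) :
    expansion A B (-x) = -expansion A B x + ![(B:ℝ)-1, 0] := by
  rw [expansion_eq, expansion_eq]
  ext i
  fin_cases i <;> simp <;> ring

lemma expansion_sub (A B p q : ℤ) (x : Pt) :
    expansion A B (x - ![(p:ℝ), (q:ℝ)])
      = expansion A B x - ![((-B * q : ℤ) : ℝ), ((p - A * q : ℤ) : ℝ)] := by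
  rw [expansion_eq, expansion_eq]
  ext i
  fin_cases i <;> simp <;> ring

lemma volume_image_expansion (A B : ℤ) (S : Set Pt) :
    MeasureTheory.volume (expansion A B '' S)
      = ENNReal.ofReal |(B:ℝ)| * MeasureTheory.volume S := by
  have h : expansion A B '' S = (fun x => x + ![((B:ℝ)-1)/2, 0]) ''
      (Matrix.toLin' !![0, -(B:ℝ); 1, -(A:ℝ)] '' S) := by
    rw [image_image]
    rfl
  rw [h, image_add_right, MeasureTheory.measure_preimage_add_right,
    MeasureTheory.Measure.addHaar_image_linearMap, LinearMap.det_toLin', Matrix.det_fin_two_of]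
  simp

section CrysEq

variable {A B : ℤ} {T : Set Pt}

lemma CrysEq.exists_expansion_eq_add (hT : CrysEq A B T) {t : Pt} (ht : t ∈ T) {i : ℤ}
    (h0 : 0 ≤ i) (h1 : i ≤ B - 2) : ∃ s ∈ T, expansion A B s = t + ![(i:ℝ), 0] := by
  have : t + ![(i:ℝ), 0] ∈ expansion A B '' T :=
    hT ▸ Or.inl (mem_iUnion₂.2 ⟨i, Finset.mem_Icc.2 ⟨h0, h1⟩, t, ht, rfl⟩)
  exact this

lemma CrysEq.exists_expansion_eq_neg (hT : CrysEq A B T) {t : Pt} (ht : t ∈ T) :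
    ∃ s ∈ T, expansion A B s = -t := by
  have : -t ∈ expansion A B '' T := hT ▸ Or.inr (Set.neg_mem_neg.2 ht)
  exact this

lemma CrysEq.expansion_mem (hT : CrysEq A B T) {t : Pt} (ht : t ∈ T) :
    (∃ i : ℤ, 0 ≤ i ∧ i ≤ B - 2 ∧ ∃ s ∈ T, expansion A B t = s + ![(i:ℝ), 0]) ∨
      -expansion A B t ∈ T := by
  have : expansion A B t ∈ _ := hT ▸ mem_image_of_mem (expansion A B) ht
  rcases this with h | h
  · obtain ⟨i, hi, s, hs, h⟩ := mem_iUnion₂.1 h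
    rw [Finset.mem_Icc] at hi
    exact Or.inl ⟨i, hi.1, hi.2, s, hs, h.symm⟩
  · exact Or.inr h

/-- The symmetrized tile `T ∪ -T` satisfies the lattice tile equation, up to translation. -/
lemma CrysEq.image_union_neg (hT : CrysEq A B T) (hB : 2 ≤ B) :
    expansion A B '' (T ∪ -T)
      = ⋃ i ∈ Finset.Icc (0:ℤ) (B-1), (fun x => x + ![(i:ℝ), 0]) '' (T ∪ -T) := by
  ext x
  simp only [mem_iUnion₂, Finset.mem_Icc, mem_image]
  constructor
  · rintro ⟨t, ht | ht, rfl⟩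
    · rcases hT.expansion_mem ht with ⟨i, h0, h1, s, hs, h⟩ | h
      · exact ⟨i, ⟨h0, by omega⟩, s, Or.inl hs, h.symm⟩
      · exact ⟨0, ⟨le_rfl, by omega⟩, expansion A B t, Or.inr h, by ext k; fin_cases k <;> simp⟩
    · have hneg := expansion_neg A B (-t)
      rw [neg_neg] at hneg
      rw [hneg]
      rcases hT.expansion_mem ht with ⟨i, h0, h1, s, hs, h⟩ | h
      · refine ⟨B - 1 - i, ⟨by omega, by omega⟩, -s, Or.inr (Set.neg_mem_neg.2 hs), ?_⟩
        rw [h]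
        ext k; fin_cases k <;> simp [Matrix.vecHead, Matrix.vecTail]
        ring
      · exact ⟨B - 1, ⟨by omega, le_rfl⟩, _, Or.inl h, by simp⟩
  · rintro ⟨i, ⟨h0, h1⟩, s, hs | hs, rfl⟩
    · rcases lt_or_eq_of_le h1 with h1 | rfl
      · obtain ⟨t, ht, h⟩ := hT.exists_expansion_eq_add hs h0 (by omega)
        exact ⟨t, Or.inl ht, h⟩
      · obtain ⟨t, ht, h⟩ := hT.exists_expansion_eq_neg hs
        refine ⟨-t, Or.inr (Set.neg_mem_neg.2 ht), ?_⟩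
        rw [expansion_neg, h]
        simp
    · rcases h0.eq_or_lt with rfl | h0
      · obtain ⟨t, ht, h⟩ := hT.exists_expansion_eq_neg hs
        exact ⟨t, Or.inl ht, by rw [h]; ext k; fin_cases k <;> simp⟩
      · obtain ⟨t, ht, h⟩ := hT.exists_expansion_eq_add hs (i := B - 1 - i) (by omega) (by omega)
        refine ⟨-t, Or.inr (Set.neg_mem_neg.2 ht), ?_⟩
        rw [expansion_neg, h]
        ext k; fin_cases k <;> simp [Matrix.vecHead, Matrix.vecTail]
        ring

end CrysEq

open MeasureTheory in
lemma measure_inter_eq_zero_of_sum_le_measure_biUnion {α ι : Type*} [MeasurableSpace α]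
    {μ : Measure α} {s : Finset ι} {S : ι → Set α} (hmeas : ∀ i ∈ s, MeasurableSet (S i))
    (hfin : ∀ i ∈ s, μ (S i) ≠ ⊤) (hle : ∑ i ∈ s, μ (S i) ≤ μ (⋃ i ∈ s, S i)) {i j : ι}
    (hi : i ∈ s) (hj : j ∈ s) (hij : i ≠ j) : μ (S i ∩ S j) = 0 := by
  classical
  have hj' : j ∈ s.erase i := Finset.mem_erase.2 ⟨hij.symm, hj⟩
  set R := ∑ k ∈ (s.erase i).erase j, μ (S k) with hR
  have hsum : ∑ k ∈ s, μ (S k) = μ (S i) + μ (S j) + R := by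
    rw [← Finset.add_sum_erase s _ hi, ← Finset.add_sum_erase _ _ hj', add_assoc]
  have hunion : μ (⋃ k ∈ s, S k) ≤ μ (S i ∪ S j) + R := by
    refine (measure_mono ?_).trans ((measure_union_le (S i ∪ S j)
      (⋃ k ∈ (s.erase i).erase j, S k)).trans (by gcongr; exact measure_biUnion_finset_le _ _))
    intro x hx
    obtain ⟨k, hk, hx⟩ := mem_iUnion₂.1 hx
    by_cases hki : k = i
    · exact Or.inl (Or.inl (hki ▸ hx))
    by_cases hkj : k = j
    · exact Or.inl (Or.inr (hkj ▸ hx))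
    · exact Or.inr (mem_iUnion₂.2 ⟨k, by simp [hki, hkj, hk], hx⟩)
  have hRfin : R ≠ ⊤ := ENNReal.sum_ne_top.2 fun k hk =>
    hfin k (Finset.mem_of_mem_erase (Finset.mem_of_mem_erase hk))
  have hUfin : μ (S i ∪ S j) ≠ ⊤ := measure_union_ne_top (hfin i hi) (hfin j hj)
  have key : μ (S i ∪ S j) + R + μ (S i ∩ S j) ≤ μ (S i ∪ S j) + R + 0 := by
    rw [add_zero, add_right_comm, measure_union_add_inter _ (hmeas j hj), ← hsum]
    exact hle.trans hunion
  exact nonpos_iff_eq_zero.1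
    ((ENNReal.add_le_add_iff_left (ENNReal.add_ne_top.2 ⟨hUfin, hRfin⟩)).1 key)

/-- The set overlaps its translate by the integer vector `(p, q)` in a null set,
unless that vector is zero. -/
def NullOverlap (L : Set Pt) (p q : ℤ) : Prop :=
  (p ≠ 0 ∨ q ≠ 0) → MeasureTheory.volume {x | x ∈ L ∧ x - ![(p:ℝ), (q:ℝ)] ∈ L} = 0

lemma NullOverlap.neg {L : Set Pt} {p q : ℤ} (h : NullOverlap L p q) :
    NullOverlap L (-p) (-q) := by
  intro hpq
  have h0 := h (by omega)
  rw [← MeasureTheory.measure_preimage_add_right _ ![(p:ℝ), (q:ℝ)]] at h0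
  refine MeasureTheory.measure_mono_null ?_ h0
  rintro x ⟨hx, hx'⟩
  have : x - ![((-p : ℤ):ℝ), ((-q : ℤ):ℝ)] = x + ![(p:ℝ), (q:ℝ)] := by
    ext k; fin_cases k <;> simp
  refine ⟨?_, ?_⟩
  · change x + ![(p:ℝ), (q:ℝ)] ∈ L
    rwa [← this]
  · change x + ![(p:ℝ), (q:ℝ)] - ![(p:ℝ), (q:ℝ)] ∈ L
    rwa [add_sub_cancel_right]

section LatticeTile

variable {A B : ℤ} {L : Set Pt}

open MeasureTheory in
lemma volume_inter_translates_eq_zero (hB : 2 ≤ B) (hL : IsCompact L)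
    (hLeq : expansion A B '' L
      = ⋃ i ∈ Finset.Icc (0:ℤ) (B-1), (fun x => x + ![(i:ℝ), 0]) '' L)
    {i j : ℤ} (hi : i ∈ Finset.Icc (0:ℤ) (B-1)) (hj : j ∈ Finset.Icc (0:ℤ) (B-1)) (hij : i ≠ j) :
    volume ((fun x => x + ![(i:ℝ), 0]) '' L ∩ (fun x => x + ![(j:ℝ), 0]) '' L) = 0 := by
  have hvol (i : ℤ) : volume ((fun x : Pt => x + ![(i:ℝ), 0]) '' L) = volume L := by
    rw [image_add_right, measure_preimage_add_right]
  refine measure_inter_eq_zero_of_sum_le_measure_biUnion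
    (S := fun i : ℤ => (fun x : Pt => x + ![(i:ℝ), 0]) '' L)
    (fun i _ => (hL.image (by fun_prop)).isClosed.measurableSet)
    (fun i _ => by rw [hvol]; exact hL.measure_lt_top.ne) ?_ hi hj hij
  rw [← hLeq, volume_image_expansion]
  simp only [hvol, Finset.sum_const, Int.card_Icc, nsmul_eq_mul]
  gcongr
  have h1 : ((B - 1 + 1 - 0).toNat : ℝ) = |(B:ℝ)| := by
    rw [abs_of_nonneg (by exact_mod_cast (by omega : 0 ≤ B))]
    exact_mod_cast (by omega : ((B - 1 + 1 - 0).toNat : ℤ) = B)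
  rw [← h1, ENNReal.ofReal_natCast]

open MeasureTheory in
lemma NullOverlap.step (hB : 2 ≤ B) (hL : IsCompact L)
    (hLeq : expansion A B '' L
      = ⋃ i ∈ Finset.Icc (0:ℤ) (B-1), (fun x => x + ![(i:ℝ), 0]) '' L)
    {p q δ : ℤ} (hδ : |δ| ≤ B - 1) (h : NullOverlap L p q) :
    NullOverlap L (-B * q + δ) (p - A * q) := by
  intro hne
  rw [abs_le] at hδ
  obtain ⟨i, j, hi, hj, hijδ⟩ : ∃ i j : ℤ, i ∈ Finset.Icc (0:ℤ) (B-1) ∧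
      j ∈ Finset.Icc (0:ℤ) (B-1) ∧ i - j = δ := by
    simp only [Finset.mem_Icc]
    exact ⟨max 0 δ, max 0 δ - δ, by omega, by omega, by omega⟩
  have hmem {i : ℤ} (hi : i ∈ Finset.Icc (0:ℤ) (B-1)) {x : Pt} (hx : x ∈ L) :
      x + ![(i:ℝ), 0] ∈ expansion A B '' L := by
    rw [hLeq]
    exact mem_iUnion₂.2 ⟨i, hi, x, hx, rfl⟩
  by_cases hpq : p ≠ 0 ∨ q ≠ 0
  · have h0 := volume_image_expansion A B {x | x ∈ L ∧ x - ![(p:ℝ), (q:ℝ)] ∈ L}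
    rw [h hpq, mul_zero, ← measure_preimage_add_right _ ![(j:ℝ), 0]] at h0
    refine measure_mono_null ?_ h0
    rintro x ⟨hx, hx'⟩
    obtain ⟨y, hy, hxy⟩ := hmem hj hx
    obtain ⟨z, hz, hxz⟩ := hmem hi hx'
    refine ⟨y, ⟨hy, ?_⟩, hxy⟩
    have hyz : expansion A B (y - ![(p:ℝ), (q:ℝ)]) = expansion A B z := by
      rw [expansion_sub, hxy, hxz, ← hijδ]
      ext k; fin_cases k <;> simp [Matrix.vecHead, Matrix.vecTail]
      ring
    have hinj : y - ![(p:ℝ), (q:ℝ)] = z := by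
      have hB0 : (B:ℝ) ≠ 0 := by exact_mod_cast (by omega : B ≠ 0)
      rw [expansion_eq, expansion_eq] at hyz
      have e0 := congrFun hyz 0
      have e1 := congrFun hyz 1
      simp only [Matrix.cons_val_zero, Matrix.cons_val_one, add_left_inj, neg_mul, neg_inj] at e0 e1
      have e0' := mul_left_cancel₀ hB0 e0
      rw [e0', sub_left_inj] at e1
      ext k; fin_cases k <;> assumption
    exact hinj ▸ hz
  · obtain ⟨rfl, rfl⟩ : p = 0 ∧ q = 0 := by omega
    have h0 := volume_inter_translates_eq_zero hB hL hLeq hj hi (by omega)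
    rw [← measure_preimage_add_right _ ![(j:ℝ), 0]] at h0
    refine measure_mono_null ?_ h0
    rintro x ⟨hx, hx'⟩
    refine ⟨⟨x, hx, rfl⟩, ⟨_, hx', ?_⟩⟩
    rw [← hijδ]
    ext k; fin_cases k <;> simp [Matrix.vecHead, Matrix.vecTail]
    ring

end LatticeTile

/-- Integer vectors reachable from zero by the digit steps of the expansion, in the coordinates
`(u, v) ↦ (u + A v, v)`. -/
lemma forall_of_digit_step {A B : ℤ} (hB2 : 2 ≤ B) (hA : 1 ≤ A) (hAB : A ≤ B) {H : ℤ → ℤ → Prop} (h0 : H 0 0)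
    (hneg : ∀ u v, H u v → H (-u) (-v))
    (hstep : ∀ u v m : ℤ, |u + A * v - B * m| ≤ B - 1 → H v (-m) → H u v) (U V : ℤ)
    (hU : 0 ≤ U) (hV : 0 ≤ V) : H (-U) V := by
  have hB : 0 < B := by omega
  suffices h : ∀ N : ℕ, ∀ U V : ℤ, 0 ≤ U → 0 ≤ V →
      (if U = 0 then 3 * V + 2 else if U ≤ V then 3 * V + 1 else 3 * U) ≤ N → H (-U) V from
    h (if U = 0 then 3 * V + 2 else if U ≤ V then 3 * V + 1 else 3 * U).toNat U V hU hV
      (Int.self_le_toNat _)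
  intro N
  induction N using Nat.strong_induction_on with
  | _ N ih =>
  intro U V hU hV hN
  have hneg' (u v : ℤ) (h : H (-u) v) : H u (-v) := by simpa using hneg _ _ h
  have rec_of_lt (U' V' : ℤ) (hU' : 0 ≤ U') (hV' : 0 ≤ V')
      (h : (if U' = 0 then 3 * V' + 2 else if U' ≤ V' then 3 * V' + 1 else 3 * U')
        < (if U = 0 then 3 * V + 2 else if U ≤ V then 3 * V + 1 else 3 * U)) : H (-U') V' := by
    refine ih (if U' = 0 then 3 * V' + 2 else if U' ≤ V' then 3 * V' + 1 else 3 * U').toNat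
      ?_ U' V' hU' hV' (Int.self_le_toNat _)
    split_ifs at h hN ⊢ <;> omega
  have rem_bound (x : ℤ) : |x - B * (x / B)| ≤ B - 1 := by
    have h1 := Int.mul_ediv_add_emod x B
    have h2 := Int.emod_nonneg x hB.ne'
    have h3 := Int.emod_lt_of_pos x hB
    rw [abs_le]; constructor <;> linarith
  rcases hU.eq_or_lt with rfl | hUpos
  · rcases hV.eq_or_lt with rfl | hVpos
    · simpa using h0
    refine hstep _ _ (A * V / B) (by simpa using rem_bound (A * V)) ?_
    have hm0 : 0 ≤ A * V / B := Int.ediv_nonneg (by positivity) hB.le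
    have hm1 : A * V / B ≤ V := by
      refine Int.ediv_le_of_le_mul hB ?_
      nlinarith
    refine hneg' _ _ (rec_of_lt _ _ hV hm0 ?_)
    split_ifs <;> omega
  rcases le_or_gt U (A * V) with hp | hp
  · have hVpos : 0 < V := by
      by_contra! h
      obtain rfl : V = 0 := by omega
      simp at hp
      omega
    refine hstep _ _ ((A * V - U) / B) (by simpa [neg_add_eq_sub] using rem_bound (A * V - U)) ?_
    have hm0 : 0 ≤ (A * V - U) / B := Int.ediv_nonneg (by omega) hB.le
    have hm1 : (A * V - U) / B < V := by
      refine Int.ediv_lt_of_lt_mul hB ?_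
      nlinarith
    refine hneg' _ _ (rec_of_lt _ _ hV hm0 ?_)
    split_ifs <;> omega
  · set m := (U - A * V) / B with hm
    have hb := rem_bound (U - A * V)
    rw [← hm] at hb
    have hVU : V < U := by nlinarith
    have hm0 : 0 ≤ m := Int.ediv_nonneg (by omega) hB.le
    have hm1 : B * m ≤ U - A * V := Int.mul_ediv_self_le hB.ne'
    refine hstep _ _ (-m) (by rw [← abs_neg]; convert hb using 2; ring) ?_
    rw [neg_neg]
    rcases hm0.eq_or_lt with h | hmpos
    · rw [← h]
      have := hneg _ _ (rec_of_lt V 0 hV le_rfl (by split_ifs <;> omega))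
      simpa using this
    refine hstep _ _ ((V + A * m) / B) (rem_bound _) ?_
    have hn0 : 0 ≤ (V + A * m) / B := Int.ediv_nonneg (by positivity) hB.le
    have hAm : A * m ≤ B * m := by gcongr
    have hAV : V ≤ A * V := by nlinarith
    have hBm : 2 * m ≤ B * m := by gcongr
    have hn1 : (V + A * m) / B < U := by
      refine Int.ediv_lt_of_lt_mul hB ?_
      nlinarith
    have hmU : m < U := by linarith
    refine hneg' _ _ (rec_of_lt _ _ hm0 hn0 ?_)
    split_ifs <;> omega

lemma NullOverlap.sub_notMem {L : Set Pt} (hL : L ⊆ closure (interior L)) {p q : ℤ}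
    (h : NullOverlap L p q) (hpq : p ≠ 0 ∨ q ≠ 0) {x : Pt} (hx : x ∈ interior L) :
    x - ![(p:ℝ), (q:ℝ)] ∉ L := by
  intro hxL
  set v : Pt := ![(p:ℝ), (q:ℝ)]
  have hopen : IsOpen ((fun y => y + v) ⁻¹' interior L) :=
    isOpen_interior.preimage (by fun_prop)
  obtain ⟨y, hy, hy'⟩ := mem_closure_iff.1 (hL hxL) _ hopen (by simpa using hx)
  have hopen' : IsOpen (interior L ∩ (fun z => z - v) ⁻¹' interior L) :=
    isOpen_interior.inter (isOpen_interior.preimage (by fun_prop))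
  refine (hopen'.measure_pos MeasureTheory.volume ⟨y + v, hy, by simpa using hy'⟩).ne' ?_
  refine MeasureTheory.measure_mono_null ?_ (h hpq)
  exact fun z hz => ⟨interior_subset hz.1, interior_subset hz.2⟩

/-- The integer multiples of `(A - σ, 1)`, where `σ` is the sign of `A`, are null overlaps. -/
lemma nullOverlap_zsmul {A B σ : ℤ} {L : Set Pt} (hσ : σ = 1 ∨ σ = -1) (hA : 1 ≤ σ * A)
    (hAB : σ * A ≤ B) (hB : 2 ≤ B) (hL : IsCompact L)
    (hLeq : expansion A B '' L
      = ⋃ i ∈ Finset.Icc (0:ℤ) (B-1), (fun x => x + ![(i:ℝ), 0]) '' L) (n : ℤ) :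
    NullOverlap L (n * (A - σ)) n := by
  have hσσ : σ * σ = 1 := by rcases hσ with rfl | rfl <;> rfl
  have hneg (u v : ℤ) (h : NullOverlap L (u + σ * v * A) (σ * v)) :
      NullOverlap L (-u + σ * -v * A) (σ * -v) := by
    convert h.neg using 1 <;> ring
  have key := forall_of_digit_step (H := fun u v => NullOverlap L (u + σ * v * A) (σ * v))
    hB hA hAB (fun h => by simp at h) hneg ?_
  · have hcast (k : ℤ) (h : NullOverlap L (-(σ * k) + σ * (σ * k) * A) (σ * (σ * k))) :
        NullOverlap L (k * (A - σ)) k := by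
      rw [← mul_assoc, hσσ, one_mul] at h
      convert h using 1
      ring
    rcases le_total 0 (σ * n) with h | h
    · exact hcast n (key _ _ h h)
    · have h' : 0 ≤ σ * -n := by linarith
      have := (hcast (-n) (key _ _ h' h')).neg
      convert this using 1 <;> ring
  · intro u v m hδ h
    have hs := NullOverlap.step hB hL hLeq hδ h
    have hs' := NullOverlap.step hB hL hLeq (δ := -(u + σ * A * v - B * m)) (by rwa [abs_neg]) h
    rcases hσ with rfl | rfl
    · convert hs using 1 <;> ring
    · convert hs'.neg using 1 <;> ring

lemma abs_add_le_of_companion_inverse {a b p q : ℝ} (ha : |a| ≤ 1) (ha' : 1/2 + 3/2 * b ≤ |a|)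
    (hb : 0 ≤ b) (hb' : b ≤ 1/3) :
    |-(b * p) - a/2 * (q - a * p)| + (1 - b)/2 * |q - a * p|
      ≤ (1 - b/2) * (|q - a/2 * p| + (1 - b)/2 * |p|) := by
  set s := q - a/2 * p with hs
  have e1 : -(b * p) - a/2 * (q - a * p) = -(a/2 * s) + (a^2/4 - b) * p := by rw [hs]; ring
  have e2 : q - a * p = s - a/2 * p := by rw [hs]; ring
  have h1 : |-(b * p) - a/2 * (q - a * p)| ≤ |a|/2 * |s| + |a^2/4 - b| * |p| := by
    rw [e1]
    refine (abs_add_le _ _).trans_eq ?_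
    rw [abs_neg, abs_mul, abs_mul, abs_div, abs_two]
  have h2 : |q - a * p| ≤ |s| + |a|/2 * |p| := by
    rw [e2]
    refine (abs_sub _ _).trans_eq ?_
    rw [abs_mul, abs_div, abs_two]
  have h3 : |a^2/4 - b| + (1 - b)/2 * (|a|/2) ≤ (1 - b/2) * ((1 - b)/2) := by
    rw [← sq_abs a]
    generalize |a| = c at *
    rcases abs_cases (c^2/4 - b) with ⟨h, -⟩ | ⟨h, -⟩ <;> rw [h] <;> nlinarith
  have h4 : |a|/2 + (1 - b)/2 ≤ 1 - b/2 := by linarith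
  have hs0 := mul_le_mul_of_nonneg_right h4 (abs_nonneg s)
  have hp0 := mul_le_mul_of_nonneg_right h3 (abs_nonneg p)
  have h2' := mul_le_mul_of_nonneg_left h2 (by linarith : 0 ≤ (1 - b)/2)
  linarith

/-- A norm on the plane, up to the triangle inequality, contracted by the inverse of the
companion matrix. -/
def tileNorm (A B : ℤ) (x : Pt) : ℝ :=
  |x 1 - (A / B : ℝ)/2 * x 0| + (1 - 1/(B:ℝ))/2 * |x 0|

section tileNorm

variable {A B : ℤ}

lemma tileNorm_neg (x : Pt) : tileNorm A B (-x) = tileNorm A B x := by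
  simp only [tileNorm, Pi.neg_apply, mul_neg, abs_neg, sub_neg_eq_add]
  rw [← abs_neg (x 1 - _)]
  congr 2
  ring

lemma tileNorm_nonneg (hB : 3 ≤ B) (x : Pt) : 0 ≤ tileNorm A B x := by
  have hB' : (3:ℝ) ≤ B := by exact_mod_cast hB
  have : 1/(B:ℝ) ≤ 1/3 := one_div_le_one_div_of_le (by norm_num) hB'
  have : 0 ≤ (1 - 1/(B:ℝ))/2 := by linarith
  unfold tileNorm
  positivity

lemma abs_div_le_one (hB : 3 ≤ B) (hAB : |A| ≤ B) : |(A / B : ℝ)| ≤ 1 := by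
  have hB' : (3:ℝ) ≤ B := by exact_mod_cast hB
  rw [abs_div, abs_of_nonneg (by linarith : (0:ℝ) ≤ B), div_le_one (by linarith)]
  exact_mod_cast hAB

lemma norm_le_tileNorm (hB : 3 ≤ B) (hAB : |A| ≤ B) (x : Pt) : ‖x‖ ≤ 3 * tileNorm A B x := by
  have hB' : (3:ℝ) ≤ B := by exact_mod_cast hB
  have hb : 1/(B:ℝ) ≤ 1/3 := one_div_le_one_div_of_le (by norm_num) hB'
  have ha := abs_div_le_one hB hAB
  have h0 := mul_le_mul_of_nonneg_right (by linarith : 1/3 ≤ (1 - 1/(B:ℝ))/2) (abs_nonneg (x 0))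
  have h1 : |x 1| ≤ |x 1 - (A / B : ℝ)/2 * x 0| + 1/2 * |x 0| := by
    calc |x 1| = |(x 1 - (A / B : ℝ)/2 * x 0) + (A / B : ℝ)/2 * x 0| := by ring_nf
      _ ≤ _ := abs_add_le _ _
      _ ≤ _ := by
        gcongr
        rw [abs_mul, abs_div _ (2:ℝ), abs_two]
        gcongr
  have hnn := abs_nonneg (x 1 - (A / B : ℝ)/2 * x 0)
  have hx0 := abs_nonneg (x 0)
  rw [pi_norm_le_iff_of_nonneg (by linarith [tileNorm_nonneg (A := A) hB x])]
  intro i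
  rw [Real.norm_eq_abs]
  unfold tileNorm
  fin_cases i
  · change |x 0| ≤ _
    linarith
  · change |x 1| ≤ _
    linarith

lemma tileNorm_sub_le (hB : 3 ≤ B) (hAB : |A| ≤ B) (h2A : B + 3 ≤ 2 * |A|) (x y : Pt) :
    tileNorm A B (x - y)
      ≤ (1 - 1/(B:ℝ)/2) * tileNorm A B (expansion A B x - expansion A B y) := by
  have hB' : (3:ℝ) ≤ B := by exact_mod_cast hB
  have hb : 1/(B:ℝ) ≤ 1/3 := one_div_le_one_div_of_le (by norm_num) hB'
  have ha := abs_div_le_one hB hAB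
  have h2A' : (B:ℝ) + 3 ≤ 2 * |(A:ℝ)| := by exact_mod_cast h2A
  have ha' : 1/2 + 3/2 * (1/(B:ℝ)) ≤ |(A / B : ℝ)| := by
    rw [abs_div, abs_of_nonneg (by linarith : (0:ℝ) ≤ B), le_div_iff₀ (by linarith)]
    field_simp
    linarith
  have key := abs_add_le_of_companion_inverse (p := -(B:ℝ) * (x 1 - y 1))
    (q := (x 0 - y 0) - A * (x 1 - y 1)) ha ha' (by positivity) hb
  have e1 : -(1/(B:ℝ) * (-(B:ℝ) * (x 1 - y 1))) = x 1 - y 1 := by field_simp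
  have e2 : (x 0 - y 0) - A * (x 1 - y 1) - (A / B : ℝ) * (-(B:ℝ) * (x 1 - y 1)) = x 0 - y 0 := by
    field_simp
    ring
  rw [e1, e2] at key
  have e3 : expansion A B x - expansion A B y
      = ![-(B:ℝ) * (x 1 - y 1), (x 0 - y 0) - A * (x 1 - y 1)] := by
    rw [expansion_eq, expansion_eq]
    ext k; fin_cases k <;> simp <;> ring
  rw [e3]
  exact key

end tileNorm

/-- Finite sets closed under the digit expansion of a crystallographic tile lie in the tile. -/
lemma CrysEq.subset_of_expansion {A B : ℤ} {T P : Set Pt} (hT : CrysEq A B T) (hB : 3 ≤ B)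
    (hAB : |A| ≤ B) (h2A : B + 3 ≤ 2 * |A|) (hne : T.Nonempty) (hcl : IsClosed T)
    (hPfin : P.Finite)
    (hP : ∀ r ∈ P, ∃ r' ∈ P, (∃ i : ℤ, 0 ≤ i ∧ i ≤ B - 2 ∧ expansion A B r = r' + ![(i:ℝ), 0]) ∨
      expansion A B r = -r') : P ⊆ T := by
  obtain ⟨t₀, ht₀⟩ := hne
  have hB' : (3:ℝ) ≤ B := by exact_mod_cast hB
  have hb : 1/(B:ℝ) ≤ 1/3 := one_div_le_one_div_of_le (by norm_num) hB'
  have hb0 : 0 < 1/(B:ℝ) := by positivity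
  obtain ⟨C, hC⟩ := (hPfin.image fun r => tileNorm A B (r - t₀)).bddAbove
  have approx (n : ℕ) : ∀ r ∈ P, ∃ t ∈ T, tileNorm A B (r - t) ≤ (1 - 1/(B:ℝ)/2) ^ n * C := by
    induction n with
    | zero => exact fun r hr => ⟨t₀, ht₀, by simpa using hC (mem_image_of_mem _ hr)⟩
    | succ n ih =>
      intro r hr
      obtain ⟨r', hr', h⟩ := hP r hr
      obtain ⟨t, ht, hrt⟩ := ih r' hr'
      obtain ⟨s, hs, hst⟩ : ∃ s ∈ T, tileNorm A B (expansion A B r - expansion A B s)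
          = tileNorm A B (r' - t) := by
        rcases h with ⟨i, h0, h1, h⟩ | h
        · obtain ⟨s, hs, hst⟩ := hT.exists_expansion_eq_add ht h0 h1
          exact ⟨s, hs, by rw [h, hst, add_sub_add_right_eq_sub]⟩
        · obtain ⟨s, hs, hst⟩ := hT.exists_expansion_eq_neg ht
          exact ⟨s, hs, by rw [h, hst, ← tileNorm_neg (r' - t), neg_sub_neg, neg_sub]⟩
      refine ⟨s, hs, (tileNorm_sub_le hB hAB h2A r s).trans ?_⟩
      rw [hst, pow_succ', mul_assoc]
      gcongr
      linarith
  intro r hr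
  rw [← hcl.closure_eq, Metric.mem_closure_iff]
  intro ε hε
  have hlim : Filter.Tendsto (fun n : ℕ => 3 * ((1 - 1/(B:ℝ)/2) ^ n * C)) Filter.atTop
      (nhds (3 * (0 * C))) :=
    ((tendsto_pow_atTop_nhds_zero_of_lt_one (by linarith) (by linarith)).mul_const C).const_mul 3
  obtain ⟨n, hn⟩ := (hlim.eventually_lt_const (by simpa using hε)).exists
  obtain ⟨t, ht, hrt⟩ := approx n r hr
  refine ⟨t, ht, ?_⟩
  rw [dist_eq_norm]
  exact (norm_le_tileNorm hB hAB _).trans_lt (by linarith)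

section OddTranslates

variable {A B σ : ℤ} {T : Set Pt}

lemma interior_neg_eq_neg_interior (S : Set Pt) : interior (-S) = -interior S :=
  ((Homeomorph.neg Pt).preimage_interior S).symm

lemma DiskLike.neg_subset_closure_interior {S : Set Pt} (hS : DiskLike S) :
    -S ⊆ closure (interior (-S)) := by
  have hc : closure (-interior S) = -closure (interior S) :=
    ((Homeomorph.neg Pt).preimage_closure _).symm
  rw [interior_neg_eq_neg_interior, hc]
  exact Set.neg_subset_neg.2 hS.subset_closure_interior

/-- A disk-like crystallographic tile contains no path which joins `x` to `x + 2 (A - σ, 1)`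
through the interior of `T ∪ -T`. -/
lemma CrysEq.false_of_path (hT : CrysEq A B T) (hσ : σ = 1 ∨ σ = -1) (hA : 1 ≤ σ * A)
    (hAB : σ * A ≤ B) (hB : 2 ≤ B) (hTc : IsCompact T) (hdisk : DiskLike T) {E : Set Pt}
    (hE : ∀ n : ℤ, ∀ x ∈ E, x - ((2*n+1 : ℤ) : ℝ) • (![(A:ℝ) - σ, 1] : Pt) ∉ E) {α : ℝ → Pt}
    (hα : ContinuousOn α (Icc 0 1)) (h1 : α 1 = α 0 + (2:ℝ) • (![(A:ℝ) - σ, 1] : Pt))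
    (hαT : ∀ t ∈ Icc (0:ℝ) 1, α t ∈ T ∪ -T)
    (hint : ∀ t ∈ Icc (0:ℝ) 1, α t ∈ interior (T ∪ -T) ∨ α t ∈ E) : False := by
  have hL : T ∪ -T ⊆ closure (interior (T ∪ -T)) := union_subset
    (hdisk.subset_closure_interior.trans (closure_mono (interior_mono subset_union_left)))
    (hdisk.neg_subset_closure_interior.trans (closure_mono (interior_mono subset_union_right)))
  refine no_path_of_odd_translates_disjoint (fun n x hx => ?_) hE hα h1 hαT hint
  have hnull := nullOverlap_zsmul hσ hA hAB hB (hTc.union hTc.neg) (hT.image_union_neg hB) (2*n+1)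
  convert hnull.sub_notMem hL (Or.inr (by omega)) hx using 3
  ext k
  fin_cases k <;> simp

lemma CrysEq.false_of_mem_sub_mem (hT : CrysEq A B T) (hσ : σ = 1 ∨ σ = -1) (hA : 1 ≤ σ * A)
    (hAB : σ * A ≤ B) (hB : 2 ≤ B) (hTc : IsCompact T) (hdisk : DiskLike T) {r : Pt} (hr : r ∈ T)
    (hr' : r - (2:ℝ) • (![(A:ℝ) - σ, 1] : Pt) ∈ T) : False := by
  have hne : r - (2:ℝ) • (![(A:ℝ) - σ, 1] : Pt) ≠ r := by
    intro h
    have := congrFun h 1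
    simp at this
  obtain ⟨α, hα, h0, h1, hint⟩ := hdisk.exists_path hr' hr hne
  have hpath (t : ℝ) (ht : t ∈ Icc (0:ℝ) 1) : α t ∈ interior T ∨
      α t ∈ ({r, r - (2:ℝ) • (![(A:ℝ) - σ, 1] : Pt)} : Set Pt) := by
    rcases ht.1.eq_or_lt with rfl | ht0
    · exact Or.inr (Or.inr h0)
    rcases ht.2.eq_or_lt with rfl | ht1
    · exact Or.inr (Or.inl h1)
    · exact Or.inl (hint t ⟨ht0, ht1⟩)
  refine hT.false_of_path hσ hA hAB hB hTc hdisk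
    (E := {r, r - (2:ℝ) • (![(A:ℝ) - σ, 1] : Pt)}) ?_ hα (by rw [h0, h1, sub_add_cancel]) ?_ ?_
  · intro n x hx hx'
    have hcoord {z : Pt} (hz : z ∈ ({r, r - (2:ℝ) • (![(A:ℝ) - σ, 1] : Pt)} : Set Pt)) :
        ∃ k : ℤ, z 1 = r 1 - (2 * k : ℤ) := by
      rcases hz with rfl | rfl
      · exact ⟨0, by simp⟩
      · exact ⟨1, by simp⟩
    obtain ⟨k, hk⟩ := hcoord hx
    obtain ⟨l, hl⟩ := hcoord hx'
    have hsub : (x - ((2*n+1 : ℤ) : ℝ) • (![(A:ℝ) - σ, 1] : Pt)) 1 = x 1 - (2*n+1 : ℤ) := by simp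
    have h : ((2*n+1 : ℤ) : ℝ) = ((2*l - 2*k : ℤ) : ℝ) := by
      rw [hsub, hk] at hl
      push_cast at hl ⊢
      linarith
    norm_cast at h
    omega
  · intro t ht
    rcases hpath t ht with h | h | h
    · exact Or.inl (interior_subset h)
    · exact Or.inl (h ▸ hr)
    · exact Or.inl (h ▸ hr')
  · exact fun t ht => (hpath t ht).imp_left fun h => interior_mono subset_union_left h

lemma CrysEq.false_of_mem_neg_mem (hT : CrysEq A B T) (hσ : σ = 1 ∨ σ = -1) (hA : 1 ≤ σ * A)
    (hAB : σ * A ≤ B) (hB : 2 ≤ B) (hTc : IsCompact T) (hdisk : DiskLike T) {y : Pt} (hy : y ∈ T)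
    (hy' : -y ∈ T) (hw : ![(A:ℝ) - σ, 1] ∈ T) (hyint : ∀ n : ℤ, y 1 ≠ n) : False := by
  set w : Pt := ![(A:ℝ) - σ, 1] with hw_def
  have hw1 : w 1 = 1 := by simp [hw_def]
  have hne : w ≠ -y := fun h => hyint (-1) (by
    have := congrFun h 1
    rw [hw1, Pi.neg_apply] at this
    push_cast
    linarith)
  have hne' : y ≠ w := fun h => hyint 1 (by rw [h, hw1]; simp)
  obtain ⟨β, hβ, hβ0, hβ1, hβint⟩ := hdisk.exists_path hw hy' hne
  obtain ⟨γ, hγ, hγ0, hγ1, hγint⟩ := hdisk.exists_path hy hw hne'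
  set α : ℝ → Pt := fun t => -β (min (2*t) 1) + γ (max (2*t-1) 0) - y with hα_def
  have hα : ContinuousOn α (Icc 0 1) := by
    refine ((ContinuousOn.neg (hβ.comp (by fun_prop) ?_)).add
      (hγ.comp (by fun_prop) ?_)).sub continuousOn_const
    · exact fun t ht => ⟨le_min (by linarith [ht.1]) zero_le_one, min_le_right _ _⟩
    · exact fun t ht => ⟨le_max_right _ _, max_le (by linarith [ht.2]) zero_le_one⟩
  have hα_left {t : ℝ} (ht : t ≤ 1/2) : α t = -β (2*t) := by
    simp only [hα_def]
    rw [min_eq_left (by linarith), max_eq_right (by linarith), hγ0, add_sub_cancel_right]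
  have hα_right {t : ℝ} (ht : 1/2 ≤ t) : α t = γ (2*t-1) := by
    simp only [hα_def]
    rw [min_eq_right (by linarith), max_eq_left (by linarith), hβ1]
    abel
  have hα0 : α 0 = -w := by rw [hα_left (by norm_num), mul_zero, hβ0]
  have hα1 : α 1 = w := by rw [hα_right (by norm_num)]; norm_num [hγ1]
  have hpath (t : ℝ) (ht : t ∈ Icc (0:ℝ) 1) :
      (-α t ∈ interior T ∨ α t ∈ interior T) ∨ α t ∈ ({-w, y, w} : Set Pt) := by
    rcases ht.1.eq_or_lt with rfl | ht0
    · exact Or.inr (Or.inl hα0)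
    rcases ht.2.eq_or_lt with rfl | ht1
    · exact Or.inr (Or.inr (Or.inr hα1))
    rcases lt_trichotomy t (1/2) with h | rfl | h
    · rw [hα_left h.le, neg_neg]
      exact Or.inl (Or.inl (hβint _ ⟨by linarith, by linarith⟩))
    · refine Or.inr (Or.inr (Or.inl ?_))
      rw [hα_right le_rfl]
      norm_num [hγ0]
    · rw [hα_right h.le]
      exact Or.inl (Or.inr (hγint _ ⟨by linarith, by linarith⟩))
  refine hT.false_of_path hσ hA hAB hB hTc hdisk (E := {-w, y, w}) ?_ hα ?_ ?_ ?_
  · rw [← hw_def]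
    rintro n x hx hx'
    have hcoord {z : Pt} (hz : z ∈ ({-w, y, w} : Set Pt)) : z 1 = -1 ∨ z 1 = y 1 ∨ z 1 = 1 := by
      rcases hz with rfl | rfl | rfl <;> simp [hw1]
    have hsub : (x - ((2*n+1 : ℤ) : ℝ) • w) 1 = x 1 - (2*n+1 : ℤ) := by simp [hw1]
    rcases hcoord hx with h | h | h <;> rcases hcoord hx' with h' | h' | h' <;>
      rw [hsub, h] at h'
    · norm_cast at h'; omega
    · exact hyint (-1 - (2*n+1)) (by rw [← h']; push_cast; ring)
    · norm_cast at h'; omega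
    · exact hyint (-1 + (2*n+1)) (by push_cast at h' ⊢; linarith)
    · have h'' : ((2*n+1 : ℤ) : ℝ) = 0 := by linarith
      norm_cast at h''; omega
    · exact hyint (1 + (2*n+1)) (by push_cast at h' ⊢; linarith)
    · norm_cast at h'; omega
    · exact hyint (1 - (2*n+1)) (by rw [← h']; push_cast; ring)
    · norm_cast at h'; omega
  · rw [hα0, hα1, ← hw_def, two_smul]
    abel
  · intro t ht
    rcases hpath t ht with (h | h) | h | h | h
    · exact Or.inr (Set.mem_neg.2 (interior_subset h))
    · exact Or.inl (interior_subset h)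
    · exact Or.inr (by rw [h]; simpa using hw)
    · exact Or.inl (h ▸ hy)
    · exact Or.inl (h ▸ hw)
  · intro t ht
    rcases hpath t ht with (h | h) | h
    · rw [← Set.mem_neg, ← interior_neg_eq_neg_interior] at h
      exact Or.inl (interior_mono subset_union_right h)
    · exact Or.inl (interior_mono subset_union_left h)
    · exact Or.inr h

end OddTranslates

section Points

variable {A B : ℤ} {T : Set Pt}

lemma CrysEq.exists_mem_sub_mem {σ : ℤ} (hT : CrysEq A B T) (hB : 3 ≤ B) (hσ : σ = 1 ∨ σ = -1)
    (hAB : σ * A ≤ B) (h2A : B + 4 ≤ 2 * (σ * A)) (hne : T.Nonempty) (hcl : IsClosed T) :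
    ∃ r ∈ T, r - (2:ℝ) • (![(A:ℝ) - σ, 1] : Pt) ∈ T := by
  have hd : (0:ℝ) < B + 1 - σ * A := by exact_mod_cast (by linarith : 0 < B + 1 - σ * A)
  obtain ⟨κ, hκ⟩ : ∃ κ : ℝ, 2 * κ * (B + 1 - σ * A) = B - 1 :=
    ⟨(B - 1) / (2 * (B + 1 - σ * A)), by field_simp⟩
  rcases hσ with rfl | rfl
  · have habs : |A| = A := abs_of_nonneg (by linarith)
    have hP := hT.subset_of_expansion hB (by omega) (by omega) hne hcl
      (P := {![κ * (A - 1), κ], ![(κ - 2) * (A - 1), κ - 2], ![(2 - κ) * (A - 1), 2 - κ]})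
      (toFinite _) ?_
    · refine ⟨_, hP (Or.inl rfl), ?_⟩
      convert hP (Or.inr (Or.inl rfl)) using 1
      ext k; fin_cases k <;> simp
      ring
    · rintro _ (rfl | rfl | rfl)
      · refine ⟨_, Or.inl rfl, Or.inr ?_⟩
        rw [expansion_eq]
        ext k; fin_cases k <;> simp <;> push_cast at hκ <;> linarith
      · refine ⟨_, Or.inr (Or.inr rfl), Or.inl ⟨2 * B - 2 * A + 2, by omega, by omega, ?_⟩⟩
        rw [expansion_eq]
        ext k; fin_cases k <;> simp <;> push_cast at hκ <;> linarith
      · refine ⟨_, Or.inr (Or.inl rfl), Or.inl ⟨2 * A - 3 - B, by omega, by omega, ?_⟩⟩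
        rw [expansion_eq]
        ext k; fin_cases k <;> simp <;> push_cast at hκ <;> linarith
  · have habs : |A| = -A := abs_of_nonpos (by linarith)
    have hP := hT.subset_of_expansion hB (by omega) (by omega) hne hcl
      (P := {![κ * (A + 1), κ], ![(κ - 2) * (A + 1), κ - 2]}) (toFinite _) ?_
    · refine ⟨_, hP (Or.inl rfl), ?_⟩
      convert hP (Or.inr rfl) using 1
      ext k; fin_cases k <;> simp
      ring
    · rintro _ (rfl | rfl)
      · refine ⟨_, Or.inl rfl, Or.inl ⟨0, le_rfl, by omega, ?_⟩⟩
        rw [expansion_eq]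
        ext k; fin_cases k <;> simp <;> push_cast at hκ <;> linarith
      · refine ⟨_, Or.inr rfl, Or.inl ⟨2 * B + 2 * A + 2, by omega, by omega, ?_⟩⟩
        rw [expansion_eq]
        ext k; fin_cases k <;> simp <;> push_cast at hκ <;> linarith

lemma CrysEq.mem_of_two_mul_eq {σ : ℤ} (hT : CrysEq A B T) (hB : 3 ≤ B) (hσ : σ = 1 ∨ σ = -1)
    (hAB : |A| ≤ B) (h2A : 2 * (σ * A) = B + 3) (hne : T.Nonempty) (hcl : IsClosed T) :
    ![(A:ℝ) - σ, 1] ∈ T := by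
  have h2A' : 2 * ((σ:ℝ) * A) = B + 3 := by exact_mod_cast h2A
  have habs : B + 3 ≤ 2 * |A| := by
    rcases hσ with rfl | rfl <;> cases abs_cases A <;> omega
  refine hT.subset_of_expansion hB hAB habs hne hcl (P := {![(A:ℝ) - σ, 1]}) (toFinite _) ?_ rfl
  rintro _ rfl
  refine ⟨_, rfl, ?_⟩
  rcases hσ with rfl | rfl
  · refine Or.inr ?_
    rw [expansion_eq]
    ext k; fin_cases k <;> simp
    push_cast at h2A'
    linarith
  · refine Or.inl ⟨0, le_rfl, by omega, ?_⟩
    rw [expansion_eq]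
    ext k; fin_cases k <;> simp
    push_cast at h2A'
    linarith

lemma CrysEq.exists_mem_neg_mem_of_five_le {σ : ℤ} (hT : CrysEq A B T) (hB : 5 ≤ B)
    (hσ : σ = 1 ∨ σ = -1) (hAB : |A| ≤ B) (h2A : 2 * (σ * A) = B + 3) (hne : T.Nonempty)
    (hcl : IsClosed T) : ∃ y ∈ T, -y ∈ T ∧ ∀ n : ℤ, y 1 ≠ n := by
  have hd : 0 < 2 * (1 + A + B) := by rcases hσ with rfl | rfl <;> omega
  have hlt : B - 3 < 2 * (1 + A + B) := by rcases hσ with rfl | rfl <;> omega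
  have hd' : (0:ℝ) < 2 * (1 + A + B) := by exact_mod_cast hd
  have hlt' : (B:ℝ) - 3 < 2 * (1 + A + B) := by exact_mod_cast hlt
  have hB' : (5:ℝ) ≤ B := by exact_mod_cast hB
  set t : ℝ := (B - 3) / (2 * (1 + A + B)) with ht_def
  have ht : t * (2 * (1 + A + B)) = B - 3 := div_mul_cancel₀ _ hd'.ne'
  have ht0 : 0 < t := div_pos (by linarith) hd'
  have ht1 : t < 1 := (div_lt_one hd').2 hlt'
  have habs : B + 3 ≤ 2 * |A| := by
    rcases hσ with rfl | rfl <;> cases abs_cases A <;> omega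
  have hP := hT.subset_of_expansion (by omega) hAB habs hne hcl
    (P := {![t * (1 + A), t], -![t * (1 + A), t]}) (toFinite _) ?_
  · refine ⟨_, hP (Or.inl rfl), hP (Or.inr rfl), fun n hn => ?_⟩
    replace hn : t = n := by simpa using hn
    rw [hn] at ht0 ht1
    norm_cast at ht0 ht1
    omega
  · rintro _ (rfl | rfl)
    · refine ⟨_, Or.inl rfl, Or.inl ⟨1, by omega, by omega, ?_⟩⟩
      rw [expansion_eq]
      ext k; fin_cases k <;> simp <;> linarith
    · refine ⟨_, Or.inr rfl, Or.inl ⟨B - 2, by omega, by omega, ?_⟩⟩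
      rw [expansion_eq]
      ext k; fin_cases k <;> simp <;> linarith

lemma CrysEq.exists_mem_neg_mem_three (hT : CrysEq 3 3 T) (hne : T.Nonempty) (hcl : IsClosed T) :
    ∃ y ∈ T, -y ∈ T ∧ ∀ n : ℤ, y 1 ≠ n := by
  have hP := hT.subset_of_expansion (by norm_num) (by norm_num) (by norm_num) hne hcl
    (P := {![-2/3, -2/9], ![2/3, 2/9], ![2/3, 0], ![-1/3, 0], ![-1, -2/3], ![0, -1/3], ![2, 1]})
    (toFinite _) ?_
  · refine ⟨_, hP (Or.inl rfl), ?_, fun n hn => ?_⟩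
    · convert hP (Or.inr (Or.inl rfl)) using 1
      ext k; fin_cases k <;> norm_num
    · have hn' : ((-2 : ℤ) : ℝ) = ((9 * n : ℤ) : ℝ) := by
        simp at hn
        push_cast
        linarith
      norm_cast at hn'
      omega
  · rintro _ (rfl | rfl | rfl | rfl | rfl | rfl | rfl)
    · refine ⟨![2/3, 0], by simp, Or.inl ⟨1, by norm_num, by norm_num, ?_⟩⟩
      rw [expansion_eq]
      ext k; fin_cases k <;> norm_num
    · refine ⟨![-1/3, 0], by simp, Or.inr ?_⟩
      rw [expansion_eq]
      ext k; fin_cases k <;> norm_num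
    · refine ⟨![-1, -2/3], by simp, Or.inr ?_⟩
      rw [expansion_eq]
      ext k; fin_cases k <;> norm_num
    · refine ⟨![0, -1/3], by simp, Or.inl ⟨1, by norm_num, by norm_num, ?_⟩⟩
      rw [expansion_eq]
      ext k; fin_cases k <;> norm_num
    · refine ⟨![2, 1], by simp, Or.inl ⟨1, by norm_num, by norm_num, ?_⟩⟩
      rw [expansion_eq]
      ext k; fin_cases k <;> norm_num
    · refine ⟨![2, 1], by simp, Or.inl ⟨0, by norm_num, by norm_num, ?_⟩⟩
      rw [expansion_eq]
      ext k; fin_cases k <;> norm_num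
    · refine ⟨![2, 1], by simp, Or.inr ?_⟩
      rw [expansion_eq]
      ext k; fin_cases k <;> norm_num

lemma CrysEq.exists_mem_neg_mem_neg_three (hT : CrysEq (-3) 3 T) (hne : T.Nonempty)
    (hcl : IsClosed T) : ∃ y ∈ T, -y ∈ T ∧ ∀ n : ℤ, y 1 ≠ n := by
  have hP := hT.subset_of_expansion (by norm_num) (by norm_num) (by norm_num) hne hcl
    (P := {![0, 1/9], ![0, -1/9], ![-1/3, 1/3], ![-4/3, 1/3], ![-1, 2/3], ![0, -1/3], ![-2, 1]})
    (toFinite _) ?_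
  · refine ⟨_, hP (Or.inl rfl), ?_, fun n hn => ?_⟩
    · convert hP (Or.inr (Or.inl rfl)) using 1
      ext k; fin_cases k <;> norm_num
    · have hn' : ((1 : ℤ) : ℝ) = ((9 * n : ℤ) : ℝ) := by
        simp at hn
        push_cast
        linarith
      norm_cast at hn'
      omega
  · rintro _ (rfl | rfl | rfl | rfl | rfl | rfl | rfl)
    · refine ⟨![-1/3, 1/3], by simp, Or.inl ⟨1, by norm_num, by norm_num, ?_⟩⟩
      rw [expansion_eq]
      ext k; fin_cases k <;> norm_num
    · refine ⟨![-4/3, 1/3], by simp, Or.inr ?_⟩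
      rw [expansion_eq]
      ext k; fin_cases k <;> norm_num
    · refine ⟨![-1, 2/3], by simp, Or.inl ⟨1, by norm_num, by norm_num, ?_⟩⟩
      rw [expansion_eq]
      ext k; fin_cases k <;> norm_num
    · refine ⟨![0, -1/3], by simp, Or.inl ⟨0, by norm_num, by norm_num, ?_⟩⟩
      rw [expansion_eq]
      ext k; fin_cases k <;> norm_num
    · refine ⟨![-2, 1], by simp, Or.inl ⟨1, by norm_num, by norm_num, ?_⟩⟩
      rw [expansion_eq]
      ext k; fin_cases k <;> norm_num
    · refine ⟨![-2, 1], by simp, Or.inr ?_⟩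
      rw [expansion_eq]
      ext k; fin_cases k <;> norm_num
    · refine ⟨![-2, 1], by simp, Or.inl ⟨0, by norm_num, by norm_num, ?_⟩⟩
      rw [expansion_eq]
      ext k; fin_cases k <;> norm_num

end Points

theorem stmt_19 (A B : ℤ) (hAB : |A| ≤ B) (hB : 2 ≤ B) (h2A : B + 3 ≤ 2 * |A|)
    (T : Set Pt) (hTne : T.Nonempty) (hTc : IsCompact T) (hT : CrysEq A B T) :
    ¬ DiskLike T := by
  intro hdisk
  have hB3 : 3 ≤ B := by omega
  obtain ⟨σ, hσ, hσA⟩ : ∃ σ : ℤ, (σ = 1 ∨ σ = -1) ∧ σ * A = |A| := by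
    rcases abs_choice A with h | h
    · exact ⟨1, Or.inl rfl, by rw [h, one_mul]⟩
    · exact ⟨-1, Or.inr rfl, by rw [h, neg_one_mul]⟩
  have hA1 : 1 ≤ σ * A := by omega
  have hAB' : σ * A ≤ B := by omega
  rcases h2A.eq_or_lt with h2A | h2A
  · have hw := hT.mem_of_two_mul_eq hB3 hσ hAB (by omega) hTne hTc.isClosed
    obtain ⟨y, hy, hy', hyint⟩ : ∃ y ∈ T, -y ∈ T ∧ ∀ n : ℤ, y 1 ≠ n := by
      rcases le_or_gt 5 B with hB5 | hB5
      · exact hT.exists_mem_neg_mem_of_five_le hB5 hσ hAB (by omega) hTne hTc.isClosed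
      obtain rfl : B = 3 := by omega
      rcases hσ with rfl | rfl
      · obtain rfl : A = 3 := by omega
        exact hT.exists_mem_neg_mem_three hTne hTc.isClosed
      · obtain rfl : A = -3 := by omega
        exact hT.exists_mem_neg_mem_neg_three hTne hTc.isClosed
    exact hT.false_of_mem_neg_mem hσ hA1 hAB' hB hTc hdisk hy hy' hw hyint
  · obtain ⟨r, hr, hr'⟩ := hT.exists_mem_sub_mem hB3 hσ hAB' (by omega) hTne hTc.isClosed
    exact hT.false_of_mem_sub_mem hσ hA1 hAB' hB hTc hdisk hr hr'
end
end
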